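/- Every connected simple graph G with m edges whose spectral radius satisfies ρ(G) > √m (a Nosal graph) has booksize bk(G) > (1/9)√m; that is, G contains two adjacent vertices with more than (1/9)√m common neighbors. -/

import Mathlib

open Classical in
/-- The (classical) real adjacency matrix of a simple graph. -/
noncomputable def adjMat {V : Type*} (G : SimpleGraph V) : Matrix V V ℝ :=
  Matrix.of fun i j => if G.Adj i j then (1 : ℝ) else 0

theorem adjMat_isHermitian {V : Type*} (G : SimpleGraph V) :
    (adjMat G).IsHermitian := by
  classical
  unfold Matrix.IsHermitian
  ext i j
  simp only [Matrix.conjTranspose_apply, adjMat, Matrix.of_apply, star_trivial]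
  by_cases h : G.Adj i j
  · simp [h, h.symm]
  · have h' : ¬ G.Adj j i := fun hh => h hh.symm
    simp [h, h']

/-- The spectral radius of a finite simple graph: the largest eigenvalue of its
adjacency matrix. -/
noncomputable def specRad {V : Type*} [Fintype V] [DecidableEq V] (G : SimpleGraph V) : ℝ :=
  ⨆ i, (adjMat_isHermitian G).eigenvalues i

/-- If adjacent vertices of a graph with adjacency function `a` have at most `r / 9` common
neighbors and a nonnegative `r`-eigenvector attains its maximum, then `r ^ 2` is at most the
number of edges. -/
theorem two_mul_sq_le_sum_of_codegree_le {V : Type*} [Fintype V] (a : V → V → ℝ)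
    (ha : ∀ v w, a v w = 0 ∨ a v w = 1) (hsymm : ∀ v w, a v w = a w v)
    (r : ℝ) (hr : 0 < r) (x : V → ℝ) (u : V) (hxu : x u = 1)
    (hx0 : ∀ v, 0 ≤ x v) (hx1 : ∀ v, x v ≤ 1)
    (heig : ∀ v, ∑ w, a v w * x w = r * x v)
    (hcodeg : ∀ v w, a v w = 1 → ∑ z, a v z * a w z ≤ r / 9) :
    2 * r ^ 2 ≤ ∑ v, ∑ w, a v w := by
  have ha0 : ∀ v w, 0 ≤ a v w := fun v w => by rcases ha v w with h | h <;> simp [h]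
  have ha1 : ∀ v w, a v w ≤ 1 := fun v w => by rcases ha v w with h | h <;> simp [h]
  obtain ⟨n, hn⟩ : ∃ n : V → ℝ, n = a u := ⟨_, rfl⟩
  obtain ⟨c, hc⟩ : ∃ c : V → ℝ, c = fun v => 1 - a u v := ⟨_, rfl⟩
  have hnc : ∀ v, c v = 1 - n v := fun v => by rw [hc, hn]
  have hn0 : ∀ v, 0 ≤ n v := fun v => by rw [hn]; exact ha0 u v
  have hc0 : ∀ v, 0 ≤ c v := fun v => by rw [hc]; exact sub_nonneg.2 (ha1 u v)
  have hc1 : ∀ v, c v ≤ 1 := fun v => by linarith [hnc v, hn0 v]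
  have hnx : ∑ v, n v * x v = r := by rw [hn, heig u, hxu, mul_one]
  -- the eigenvalue equation summed over the neighbors of `u`
  have hsq : ∑ v, ∑ w, n v * a v w * x w = r ^ 2 := by
    calc _ = ∑ v, r * (n v * x v) := Finset.sum_congr rfl fun v _ => by
            rw [mul_left_comm, ← heig v, Finset.mul_sum]
            exact Finset.sum_congr rfl fun w _ => by ring
      _ = r ^ 2 := by rw [← Finset.mul_sum, hnx, sq]
  obtain ⟨gain, hgain⟩ : ∃ s, s = ∑ v, ∑ w, n v * n w * a v w * (2 * x w - 1) := ⟨_, rfl⟩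
  obtain ⟨cross, hcross⟩ : ∃ s, s = ∑ v, ∑ w, n v * c w * a v w * (1 - x w) := ⟨_, rfl⟩
  obtain ⟨outer, houter⟩ : ∃ s, s = ∑ v, ∑ w, c v * c w * a v w := ⟨_, rfl⟩
  obtain ⟨non, hnon⟩ : ∃ s, s = ∑ v, ∑ w, n v * x v * (c w * (1 - a v w) * x w) := ⟨_, rfl⟩
  have hbalance : 2 * r ^ 2 - ∑ v, ∑ w, a v w = gain - 2 * cross - outer := by
    have hswap : ∑ v, ∑ w, c v * n w * a v w = ∑ v, ∑ w, n v * c w * a v w := by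
      rw [Finset.sum_comm]
      exact Finset.sum_congr rfl fun v _ => Finset.sum_congr rfl fun w _ => by
        rw [hsymm w v]; ring
    have hzero : 2 * ∑ v, ∑ w, n v * a v w * x w - ∑ v, ∑ w, a v w
        - (gain - 2 * cross - outer)
        = ∑ v, ∑ w, n v * c w * a v w - ∑ v, ∑ w, c v * n w * a v w := by
      simp only [hgain, hcross, houter, Finset.mul_sum, ← Finset.sum_sub_distrib]
      exact Finset.sum_congr rfl fun v _ => Finset.sum_congr rfl fun w _ => by
        rw [hnc v, hnc w]; ring
    rw [hsq, hswap] at hzero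
    linarith
  have hcross0 : 0 ≤ cross := by
    rw [hcross]
    refine Finset.sum_nonneg fun v _ => Finset.sum_nonneg fun w _ => ?_
    exact mul_nonneg (mul_nonneg (mul_nonneg (hn0 v) (hc0 w)) (ha0 v w))
      (sub_nonneg.2 (hx1 w))
  have hnon_le : non ≤ cross + outer := by
    have h1 : ∑ v, ∑ w, n v * x v * (c w * x w) = ∑ w, ∑ v, c w * a w v * x v := by
      rw [← Finset.sum_mul_sum, hnx, Finset.mul_sum]
      refine Finset.sum_congr rfl fun w _ => ?_
      rw [mul_left_comm, ← heig w, Finset.mul_sum]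
      exact Finset.sum_congr rfl fun v _ => by ring
    have h2 : ∑ w, ∑ v, c w * a w v * x v = ∑ v, ∑ w, c w * a v w * x v := by
      rw [Finset.sum_comm]
      exact Finset.sum_congr rfl fun v _ => Finset.sum_congr rfl fun w _ => by
        rw [hsymm w v]
    have h3 : ∑ v, ∑ w, n v * x v * (c w * (1 - a v w) * x w)
        = ∑ v, ∑ w, (n v * c w * a v w * (x v * (1 - x w)) + c v * c w * a v w * x v) := by
      rw [← sub_eq_zero, ← sub_eq_zero.2 (h1.trans h2)]
      simp only [← Finset.sum_sub_distrib]
      exact Finset.sum_congr rfl fun v _ => Finset.sum_congr rfl fun w _ => by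
        rw [hnc v]; ring
    rw [hnon, h3, hcross, houter]
    simp only [← Finset.sum_add_distrib]
    refine Finset.sum_le_sum fun v _ => Finset.sum_le_sum fun w _ => add_le_add ?_ ?_
    · exact mul_le_mul_of_nonneg_left
        (mul_le_of_le_one_left (sub_nonneg.2 (hx1 w)) (hx1 v))
        (mul_nonneg (mul_nonneg (hn0 v) (hc0 w)) (ha0 v w))
    · exact mul_le_of_le_one_right
        (mul_nonneg (mul_nonneg (hc0 v) (hc0 w)) (ha0 v w)) (hx1 v)
  obtain ⟨M, hM⟩ : ∃ M : V → ℝ, M = fun v => ∑ w, c w * (1 - a v w) * x w := ⟨_, rfl⟩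
  have hM0 : ∀ v, 0 ≤ M v := fun v => by
    rw [hM]
    exact Finset.sum_nonneg fun w _ =>
      mul_nonneg (mul_nonneg (hc0 w) (sub_nonneg.2 (ha1 v w))) (hx0 w)
  have hdeg : ∀ v, n v = 1 → ∑ w, n w * a v w ≤ r / 9 := fun v hv => by
    rw [hn] at hv ⊢
    exact hcodeg u v hv
  have hM_le : ∀ v w, n w = 1 → a v w = 1 → r * x w - 2 * (r / 9) ≤ M v := by
    intro v w hw hvw
    have h1 := hdeg w hw
    have h2 := hcodeg v w hvw
    have h3 : r * x w ≤ M v + ∑ z, n z * a w z + ∑ z, a v z * a w z := by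
      rw [← heig w, hM, ← Finset.sum_add_distrib, ← Finset.sum_add_distrib]
      refine Finset.sum_le_sum fun z _ => ?_
      have hz0 := hx0 z
      have hz1 := hx1 z
      have hnz : n z = 0 ∨ n z = 1 := by rw [hn]; exact ha u z
      rw [hnc z]
      rcases hnz with h | h <;> rcases ha v z with h' | h' <;> rcases ha w z with h'' | h'' <;>
        rw [h, h', h''] <;> linarith
    linarith
  have hnon_eq : non = ∑ v, n v * x v * M v := by
    rw [hnon, hM]
    exact Finset.sum_congr rfl fun v _ => (Finset.mul_sum _ _ _).symm
  have hT : ∑ v, ∑ w, n v * n w * a v w * (x v * M v) ≤ r / 9 * non := by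
    rw [hnon_eq, Finset.mul_sum]
    refine Finset.sum_le_sum fun v _ => ?_
    have h1 : ∑ w, n v * n w * a v w * (x v * M v)
        = (n v * x v * M v) * ∑ w, n w * a v w := by
      rw [Finset.mul_sum]
      exact Finset.sum_congr rfl fun w _ => by ring
    rw [h1, mul_comm]
    have hnv : n v = 0 ∨ n v = 1 := by rw [hn]; exact ha u v
    rcases hnv with h | h
    · simp [h]
    · exact mul_le_mul_of_nonneg_right (hdeg v h)
        (mul_nonneg (mul_nonneg (hn0 v) (hx0 v)) (hM0 v))
  have hswap : ∀ f : V → ℝ, ∑ v, ∑ w, n v * n w * a v w * f w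
      = ∑ v, ∑ w, n v * n w * a v w * f v := fun f => by
    rw [Finset.sum_comm]
    exact Finset.sum_congr rfl fun v _ => Finset.sum_congr rfl fun w _ => by
      rw [hsymm w v]; ring
  have hedge : ∀ y z p q : ℝ, 0 ≤ y → y ≤ 1 → 0 ≤ z → z ≤ y → 0 ≤ p → 0 ≤ q →
      r * y - 2 * (r / 9) ≤ q → 2 * (r / 9) * (y + z - 1) ≤ y * p + z * q := by
    intro y z p q hy0 hy1 hz0 hzy hp hq hyq
    have hyp := mul_nonneg hy0 hp
    rcases le_total (y + z) 1 with h | h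
    · have h1 : 2 * (r / 9) * (y + z - 1) ≤ 0 :=
        mul_nonpos_of_nonneg_of_nonpos (by positivity) (by linarith)
      linarith [mul_nonneg hz0 hq]
    · have h1 : 2 * (r / 9) * (y + z - 1) ≤ 2 * (r / 9) * z :=
        mul_le_mul_of_nonneg_left (by linarith) (by positivity)
      have h2 : r * (1 / 2) ≤ r * y := mul_le_mul_of_nonneg_left (by linarith) hr.le
      have h3 : z * (2 * (r / 9)) ≤ z * q := mul_le_mul_of_nonneg_left (by linarith) hz0
      linarith
  have hgain_le : r / 9 * gain ≤ r / 9 * non := by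
    refine le_trans ?_ hT
    have h1 : 2 * ∑ v, ∑ w, n v * n w * a v w * (x v * M v)
        = ∑ v, ∑ w, n v * n w * a v w * (x v * M v + x w * M w) := by
      simp only [mul_add, Finset.sum_add_distrib]
      rw [hswap fun v => x v * M v]
      ring
    have h2 : 2 * gain = ∑ v, ∑ w, n v * n w * a v w * (2 * (x v + x w - 1)) := by
      rw [two_mul]
      nth_rewrite 1 [hgain]
      rw [hgain, hswap fun v => 2 * x v - 1]
      nth_rewrite 2 [← hswap fun v => 2 * x v - 1]
      simp only [← Finset.sum_add_distrib]
      exact Finset.sum_congr rfl fun v _ => Finset.sum_congr rfl fun w _ => by ring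
    have h3 : r / 9 * (2 * gain) ≤ 2 * ∑ v, ∑ w, n v * n w * a v w * (x v * M v) := by
      rw [h1, h2, Finset.mul_sum]
      refine Finset.sum_le_sum fun v _ => ?_
      rw [Finset.mul_sum]
      refine Finset.sum_le_sum fun w _ => ?_
      have hnv : n v = 0 ∨ n v = 1 := by rw [hn]; exact ha u v
      have hnw : n w = 0 ∨ n w = 1 := by rw [hn]; exact ha u w
      rcases hnv with hv | hv
      · simp [hv]
      rcases hnw with hw | hw
      · simp [hw]
      rcases ha v w with hvw | hvw
      · simp [hvw]
      have hwv : a w v = 1 := by rw [hsymm w v, hvw]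
      rw [hv, hw, hvw]
      rcases le_total (x w) (x v) with h | h
      · linarith [hedge (x v) (x w) (M v) (M w) (hx0 v) (hx1 v) (hx0 w) h (hM0 v) (hM0 w)
          (hM_le w v hv hwv)]
      · linarith [hedge (x w) (x v) (M w) (M v) (hx0 w) (hx1 w) (hx0 v) h (hM0 w) (hM0 v)
          (hM_le v w hw hvw)]
    linarith
  have hfin := le_of_mul_le_mul_left hgain_le (by positivity : 0 < r / 9)
  linarith

namespace Matrix.IsHermitian

variable {V : Type*} [Fintype V] [DecidableEq V] {A : Matrix V V ℝ}

theorem posSemidef_smul_one_sub (hA : A.IsHermitian) {r : ℝ}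
    (h : ∀ i, hA.eigenvalues i ≤ r) : (r • (1 : Matrix V V ℝ) - A).PosSemidef := by
  have hD : (diagonal fun i => r - hA.eigenvalues i).PosSemidef :=
    posSemidef_diagonal_iff.2 fun i => sub_nonneg.2 (h i)
  have heq : r • (1 : Matrix V V ℝ) - A = Unitary.conjStarAlgAut ℝ (Matrix V V ℝ)
      hA.eigenvectorUnitary (diagonal fun i => r - hA.eigenvalues i) := by
    have hdiag : (diagonal fun i => r - hA.eigenvalues i)
        = r • (1 : Matrix V V ℝ) - diagonal (RCLike.ofReal ∘ hA.eigenvalues) := by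
      rw [smul_one_eq_diagonal, diagonal_sub]
      rfl
    rw [hdiag, map_sub, map_smul, map_one, ← hA.spectral_theorem]
  rw [heq, Unitary.conjStarAlgAut_apply]
  exact hD.mul_mul_conjTranspose_same _

/-- A real symmetric matrix with nonnegative entries has a nonnegative eigenvector for its
largest eigenvalue, which can be scaled so that its largest coordinate is `1`. -/
theorem exists_nonneg_eigenvector (hA : A.IsHermitian) (hA0 : ∀ v w, 0 ≤ A v w) (i : V)
    (hi : ∀ j, hA.eigenvalues j ≤ hA.eigenvalues i) :
    ∃ (x : V → ℝ) (u : V), x u = 1 ∧ (∀ v, 0 ≤ x v) ∧ (∀ v, x v ≤ 1) ∧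
      A *ᵥ x = hA.eigenvalues i • x := by
  set r := hA.eigenvalues i
  have hB := hA.posSemidef_smul_one_sub hi
  obtain ⟨y, hy⟩ : ∃ y : V → ℝ, y = (hA.eigenvectorBasis i).ofLp := ⟨_, rfl⟩
  have hAy : A *ᵥ y = r • y := by rw [hy]; exact hA.mulVec_eigenvectorBasis i
  have hy0 : y ≠ 0 := fun h =>
    hA.eigenvectorBasis.toBasis.ne_zero i (by
      rw [OrthonormalBasis.coe_toBasis]
      ext v
      exact congrFun (hy.symm.trans h) v)
  have hexp : ∀ z : V → ℝ, star z ⬝ᵥ ((r • (1 : Matrix V V ℝ) - A) *ᵥ z)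
      = r * ∑ v, z v * z v - ∑ v, ∑ w, A v w * (z v * z w) := fun z => by
    simp only [star_trivial, sub_mulVec, smul_mulVec, one_mulVec, dotProduct_sub,
      dotProduct_smul, smul_eq_mul]
    simp only [dotProduct, mulVec, Finset.mul_sum]
    congr 1
    exact Finset.sum_congr rfl fun v _ => Finset.sum_congr rfl fun w _ => by ring
  have hBy : star y ⬝ᵥ ((r • (1 : Matrix V V ℝ) - A) *ᵥ y) = 0 := by
    rw [sub_mulVec, smul_mulVec, one_mulVec, hAy, sub_self, dotProduct_zero]
  have habs : A *ᵥ (fun v => |y v|) = r • fun v => |y v| := by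
    have hle : star (fun v => |y v|) ⬝ᵥ ((r • (1 : Matrix V V ℝ) - A) *ᵥ fun v => |y v|) ≤ 0 := by
      rw [← hBy, hexp, hexp]
      simp only [abs_mul_abs_self, ← abs_mul]
      exact sub_le_sub_left (Finset.sum_le_sum fun v _ => Finset.sum_le_sum fun w _ =>
        mul_le_mul_of_nonneg_left (le_abs_self _) (hA0 v w)) _
    have hker := (hB.dotProduct_mulVec_zero_iff _).1
      (le_antisymm hle (hB.dotProduct_mulVec_nonneg _))
    rw [sub_mulVec, smul_mulVec, one_mulVec, sub_eq_zero] at hker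
    exact hker.symm
  have : Nonempty V := ⟨i⟩
  obtain ⟨u, hu⟩ := Finite.exists_max fun v => |y v|
  have hu0 : 0 < |y u| := by
    obtain ⟨v, hv⟩ := Function.ne_iff.1 hy0
    exact (abs_pos.2 hv).trans_le (hu v)
  refine ⟨|y u|⁻¹ • fun v => |y v|, u, inv_mul_cancel₀ hu0.ne',
    fun v => mul_nonneg (inv_nonneg.2 hu0.le) (abs_nonneg _), fun v => ?_, ?_⟩
  · exact (mul_le_mul_of_nonneg_left (hu v) (inv_nonneg.2 hu0.le)).trans_eq
      (inv_mul_cancel₀ hu0.ne')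
  · rw [mulVec_smul, habs, smul_comm]

end Matrix.IsHermitian

theorem sum_adjMat {V : Type*} [Fintype V] (G : SimpleGraph V) :
    ∑ v, ∑ w, adjMat G v w = 2 * (G.edgeSet.ncard : ℝ) := by
  classical
  have h1 : ∀ v, ∑ w, adjMat G v w = (G.degree v : ℝ) := fun v => by
    simp [adjMat, ← SimpleGraph.card_neighborFinset_eq_degree,
      SimpleGraph.neighborFinset_eq_filter]
  have h2 : G.edgeSet.ncard = G.edgeFinset.card := Set.ncard_eq_toFinset_card' _
  rw [h2]
  simp only [h1]
  exact_mod_cast G.sum_degrees_eq_twice_card_edges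

theorem sum_adjMat_mul_adjMat {V : Type*} [Fintype V] (G : SimpleGraph V) (v w : V) :
    ∑ z, adjMat G v z * adjMat G w z
      = ((G.neighborSet v ∩ G.neighborSet w).ncard : ℝ) := by
  classical
  have h : (G.neighborSet v ∩ G.neighborSet w)
      = ((Finset.univ.filter fun z => G.Adj v z ∧ G.Adj w z : Finset V) : Set V) := by
    ext z
    simp
  rw [h, Set.ncard_coe_finset]
  simp [adjMat, ← ite_and, and_comm]

/-- Every connected Nosal graph (`ρ(G) > √m`) has booksize
`bk(G) > (1/9)√m`: it contains two adjacent vertices with more than `(1/9)√m`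
common neighbors. -/
theorem nosal_booksize {V : Type*} [Fintype V] [DecidableEq V]
    (G : SimpleGraph V) (hconn : G.Connected)
    (m : ℕ) (hm : G.edgeSet.ncard = m)
    (hNosal : Real.sqrt m < specRad G) :
    ∃ u v, G.Adj u v ∧
      (1 / 9 : ℝ) * Real.sqrt m < ((G.neighborSet u ∩ G.neighborSet v).ncard : ℝ) := by
  classical
  by_contra! hbook
  have hne : Nonempty V := hconn.nonempty
  have hA := adjMat_isHermitian G
  obtain ⟨i, hi⟩ := Finite.exists_max hA.eigenvalues
  have hrad : specRad G = hA.eigenvalues i :=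
    le_antisymm (ciSup_le hi) (le_ciSup (Set.finite_range hA.eigenvalues).bddAbove i)
  rw [hrad] at hNosal
  have h01 : ∀ v w, adjMat G v w = 0 ∨ adjMat G v w = 1 := fun v w => by
    by_cases h : G.Adj v w <;> simp [adjMat, h]
  have hA0 : ∀ v w, 0 ≤ adjMat G v w := fun v w => by rcases h01 v w with h | h <;> simp [h]
  obtain ⟨x, u, hxu, hx0, hx1, hx⟩ := hA.exists_nonneg_eigenvector hA0 i hi
  have hpos := (Real.sqrt_nonneg (m : ℝ)).trans_lt hNosal
  have hle := two_mul_sq_le_sum_of_codegree_le (adjMat G) h01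
    (fun v w => by simp [adjMat, G.adj_comm v w]) (hA.eigenvalues i) hpos x u hxu hx0 hx1
    (fun v => congrFun hx v) (fun v w hvw => by
      have hadj : G.Adj v w := by
        by_contra h
        simp [adjMat, h] at hvw
      rw [sum_adjMat_mul_adjMat]
      linarith [hbook v w hadj])
  rw [sum_adjMat, hm] at hle
  have hlt := Real.lt_sq_of_sqrt_lt hNosal
  linarith
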